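/- arXiv:2502.13118 — 4 statements merged into one kernel-verified Lean document; each statement's English description precedes it below -/
import Mathlib

section
/- For every n ≥ 1, the Grundy value of the position P'_n of the Normal Domination Game is equal to n % 4. -/
open SimpleGraph Finset

/-- A vertex `u` is dominated by the selected set `S` if it lies in the closed
neighborhood of some selected vertex. -/
def Dominated {V : Type} (G : SimpleGraph V) (S : Finset V) (u : V) : Prop :=
  ∃ s ∈ S, u = s ∨ G.Adj s u

/-- A vertex `v` is playable in position `S` if some vertex of the closed
neighborhood of `v` is not dominated by `S`. -/
def Playable {V : Type} (G : SimpleGraph V) (S : Finset V) (v : V) : Prop :=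
  ∃ u, (u = v ∨ G.Adj v u) ∧ ¬ Dominated G S u

lemma Playable.not_mem {V : Type} {G : SimpleGraph V} {S : Finset V} {v : V}
    (h : Playable G S v) : v ∉ S := by
  intro hv
  obtain ⟨u, hu, hnd⟩ := h
  exact hnd ⟨v, hv, hu.imp id (fun a => a)⟩

lemma Playable.card_lt {V : Type} [Fintype V] [DecidableEq V]
    {G : SimpleGraph V} {S : Finset V} {v : V} (h : Playable G S v) :
    (Finset.univ \ insert v S).card < (Finset.univ \ S).card := by
  apply Finset.card_lt_card
  refine ⟨Finset.sdiff_subset_sdiff (le_refl _) (Finset.subset_insert v S), ?_⟩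
  intro hsub
  have hv : v ∈ Finset.univ \ S := by simp [h.not_mem]
  have := hsub hv
  simp at this

/-- The Grundy value (nimber) of a position of the Normal Domination Game:
the minimum excludant (least natural number not attained) of the Grundy values
of the positions reachable in one move (i.e. by selecting a playable vertex). -/
noncomputable def grundy {V : Type} [Fintype V] [DecidableEq V]
    (G : SimpleGraph V) (S : Finset V) : ℕ :=
  sInf {m : ℕ |
    m ∉ Set.range fun v : {v : V // Playable G S v} => grundy G (insert v.1 S)}
termination_by (Finset.univ \ S).card
decreasing_by exact v.2.card_lt

/-- The position `P'ₙ`: the path on `n + 2` vertices in which the first vertex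
is the only selected vertex. Its Grundy value. -/
noncomputable def grundyP' (n : ℕ) : ℕ :=
  grundy (SimpleGraph.pathGraph (n + 2)) {(0 : Fin (n + 2))}

lemma grundy_eq_of {V : Type} [Fintype V] [DecidableEq V] {G : SimpleGraph V} {S : Finset V}
    {x : ℕ} (hne : ∀ v, Playable G S v → grundy G (insert v S) ≠ x)
    (hlt : ∀ m < x, ∃ v, Playable G S v ∧ grundy G (insert v S) = m) :
    grundy G S = x := by
  rw [grundy]
  have hx : x ∈ {m : ℕ |
      m ∉ Set.range fun v : {v : V // Playable G S v} => grundy G (insert v.1 S)} := by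
    rintro ⟨⟨v, hv⟩, h⟩
    exact hne v hv h
  refine le_antisymm (Nat.sInf_le hx) (le_csInf ⟨x, hx⟩ fun m hm => ?_)
  by_contra! h
  obtain ⟨v, hv, hm'⟩ := hlt m h
  exact hm ⟨⟨v, hv⟩, hm'⟩

/-- The Grundy value of the stretch between two consecutive selected vertices at distance `d`. -/
def gapValue (d : ℕ) : ℕ := (d - 3) % 4

/-- The least element of `T` above `s` (and `0` if there is none). -/
noncomputable def nextElem (T : Finset ℕ) (s : ℕ) : ℕ := sInf {t | t ∈ T ∧ s < t}

/-- The nim-sum of the values of `f` over `S`. -/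
def nimSum {α : Type*} (f : α → ℕ) (S : Finset α) : ℕ := S.fold (· ^^^ ·) 0 f

lemma nimSum_insert {α : Type*} [DecidableEq α] {f : α → ℕ} {S : Finset α} {a : α}
    (ha : a ∉ S) : nimSum f (insert a S) = f a ^^^ nimSum f S :=
  Finset.fold_insert ha

/-- The nim-sum of the values of the gaps between consecutive elements of `T`. -/
noncomputable def gapSum (T : Finset ℕ) : ℕ :=
  nimSum (fun s => gapValue (nextElem T s - s)) T

/-- `q` is the successor of `p` in `T`. -/
def Consecutive (T : Finset ℕ) (p q : ℕ) : Prop :=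
  p ∈ T ∧ q ∈ T ∧ p < q ∧ ∀ t ∈ T, p < t → q ≤ t

lemma nextElem_eq {T : Finset ℕ} {p q : ℕ} (hq : q ∈ T) (hpq : p < q)
    (h : ∀ t ∈ T, p < t → q ≤ t) : nextElem T p = q :=
  le_antisymm (Nat.sInf_le ⟨hq, hpq⟩) (le_csInf ⟨q, hq, hpq⟩ fun t ht => h t ht.1 ht.2)

lemma exists_consecutive_of_between {T : Finset ℕ} {a b v : ℕ} (ha : a ∈ T) (hb : b ∈ T)
    (hav : a < v) (hvb : v < b) (hv : v ∉ T) :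
    ∃ p q, Consecutive T p q ∧ p < v ∧ v < q := by
  have h1 : (T.filter (· < v)).Nonempty := ⟨a, by simp [ha, hav]⟩
  have h2 : (T.filter (v < ·)).Nonempty := ⟨b, by simp [hb, hvb]⟩
  have hp := Finset.max'_mem _ h1
  have hq := Finset.min'_mem _ h2
  rw [Finset.mem_filter] at hp hq
  refine ⟨_, _, ⟨hp.1, hq.1, hp.2.trans hq.2, fun t ht hpt => ?_⟩, hp.2, hq.2⟩
  rcases lt_trichotomy t v with h | rfl | h
  · exact absurd (Finset.le_max' (T.filter (· < v)) t (by simp [ht, h])) (not_le.mpr hpt)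
  · exact absurd ht hv
  · exact Finset.min'_le _ _ (by simp [ht, h])

lemma exists_consecutive_of_lt {T : Finset ℕ} {p b : ℕ} (hp : p ∈ T) (hb : b ∈ T) (hpb : p < b) :
    ∃ q, Consecutive T p q := by
  have h2 : (T.filter (p < ·)).Nonempty := ⟨b, by simp [hb, hpb]⟩
  have hq := Finset.min'_mem _ h2
  rw [Finset.mem_filter] at hq
  exact ⟨_, hp, hq.1, hq.2, fun t ht hpt => Finset.min'_le _ _ (by simp [ht, hpt])⟩

lemma gapSum_insert {T : Finset ℕ} {p q v : ℕ} (h : Consecutive T p q) (hpv : p < v)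
    (hvq : v < q) :
    gapSum (insert v T) =
      gapSum T ^^^ gapValue (q - p) ^^^ (gapValue (v - p) ^^^ gapValue (q - v)) := by
  obtain ⟨hp, hq, hpq, hmin⟩ := h
  have hv : v ∉ T := fun hv => absurd (hmin v hv hpv) (by omega)
  have hnv : nextElem (insert v T) v = q := by
    refine nextElem_eq (by simp [hq]) hvq fun t ht hvt => ?_
    rcases Finset.mem_insert.mp ht with rfl | ht
    · omega
    · exact hmin t ht (by omega)
  have hnp : nextElem (insert v T) p = v := by
    refine nextElem_eq (by simp) hpv fun t ht hpt => ?_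
    rcases Finset.mem_insert.mp ht with rfl | ht
    · omega
    · exact hvq.le.trans (hmin t ht hpt)
  have hrest : ∀ s ∈ T.erase p, nextElem (insert v T) s = nextElem T s := by
    intro s hs
    obtain ⟨hsp, hs⟩ := Finset.mem_erase.mp hs
    rcases lt_or_ge s p with hlt | hge
    · obtain ⟨r, -, hr, hsr, hrmin⟩ := exists_consecutive_of_lt hs hp hlt
      rw [nextElem_eq hr hsr hrmin]
      refine nextElem_eq (by simp [hr]) hsr fun t ht hst => ?_
      rcases Finset.mem_insert.mp ht with rfl | ht
      · exact (hrmin p hp hlt).trans hpv.le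
      · exact hrmin t ht hst
    · have hqs := hmin s hs (by omega)
      unfold nextElem
      congr 1
      ext t
      simp only [Finset.mem_insert, Set.mem_ofPred_eq]
      constructor
      · rintro ⟨rfl | ht, hst⟩
        · omega
        · exact ⟨ht, hst⟩
      · rintro ⟨ht, hst⟩
        exact ⟨Or.inr ht, hst⟩
  have hT : gapSum T = gapValue (q - p) ^^^
      nimSum (fun s => gapValue (nextElem T s - s)) (T.erase p) := by
    unfold gapSum
    conv_lhs => rw [← Finset.insert_erase hp]
    rw [nimSum_insert (Finset.notMem_erase p T), Finset.insert_erase hp,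
      nextElem_eq hq hpq hmin]
  have hvT : gapSum (insert v T) = gapValue (q - v) ^^^ (gapValue (v - p) ^^^
      nimSum (fun s => gapValue (nextElem T s - s)) (T.erase p)) := by
    unfold gapSum
    rw [nimSum_insert hv, hnv]
    congr 1
    conv_lhs => rw [← Finset.insert_erase hp]
    rw [nimSum_insert (Finset.notMem_erase p T), Finset.insert_erase hp, hnp]
    congr 1
    exact Finset.fold_congr fun s hs => by rw [hrest s hs]
  rw [hT, hvT]
  generalize nimSum (fun s => gapValue (nextElem T s - s)) (T.erase p) = X
  apply Nat.eq_of_testBit_eq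
  intro i
  simp only [Nat.testBit_xor]
  grind

lemma exists_xor_lt_of_lt_nimSum {α : Type*} [DecidableEq α] (f : α → ℕ) (S : Finset α) :
    ∀ m < nimSum f S, ∃ s ∈ S, m ^^^ nimSum f S ^^^ f s < f s := by
  induction S using Finset.induction_on with
  | empty => simp [nimSum]
  | insert a S ha ih =>
    intro m hm
    rw [nimSum_insert ha] at hm ⊢
    rcases Nat.lt_xor_cases hm with h | h
    · refine ⟨a, by simp, ?_⟩
      convert h using 1
      rw [Nat.xor_comm (f a), ← Nat.xor_assoc, Nat.xor_assoc _ (f a), Nat.xor_self, Nat.xor_zero]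
    · obtain ⟨s, hs, hlt⟩ := ih _ h
      refine ⟨s, by simp [hs], ?_⟩
      rwa [← Nat.xor_assoc m]

lemma gapValue_split_ne {d k : ℕ} (hd : 4 ≤ d) (hk : 0 < k) (hkd : k < d) :
    gapValue k ^^^ gapValue (d - k) ≠ gapValue d := by
  intro h
  unfold gapValue at h
  rcases Nat.lt_or_ge k 3 with h3 | h3
  · rw [show k - 3 = 0 by omega] at h
    simp at h
    omega
  rcases Nat.lt_or_ge (d - k) 3 with h4 | h4
  · rw [show d - k - 3 = 0 by omega] at h
    simp at h
    omega
  · have := congrArg (· % 2) h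
    simp only [Nat.xor_mod_two_eq] at this
    omega

lemma exists_gapValue_split {d t : ℕ} (ht : t < gapValue d) :
    ∃ k, 0 < k ∧ k ≤ 3 ∧ k + 3 ≤ d ∧ 4 ≤ d ∧ gapValue k ^^^ gapValue (d - k) = t := by
  unfold gapValue at *
  refine ⟨(d - 3) % 4 - t, by omega, by omega, by omega, by omega, ?_⟩
  rw [show (d - 3) % 4 - t - 3 = 0 by omega]
  simp only [Nat.zero_mod, Nat.zero_xor]
  omega

/-- The selected positions on the path with `N` vertices, together with a virtual selected
position `N + 1` marking the right end. -/
def markedPositions {N : ℕ} (S : Finset (Fin N)) : Finset ℕ :=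
  insert (N + 1) (S.image Fin.val)

lemma mem_markedPositions {N : ℕ} {S : Finset (Fin N)} {t : ℕ} :
    t ∈ markedPositions S ↔ t = N + 1 ∨ ∃ h : t < N, (⟨t, h⟩ : Fin N) ∈ S := by
  unfold markedPositions
  simp only [Finset.mem_insert, Finset.mem_image]
  refine or_congr Iff.rfl ⟨?_, fun ⟨h, hS⟩ => ⟨_, hS, rfl⟩⟩
  rintro ⟨x, hx, rfl⟩
  exact ⟨x.2, hx⟩

lemma markedPositions_insert {N : ℕ} (S : Finset (Fin N)) (v : Fin N) :
    markedPositions (insert v S) = insert v.val (markedPositions S) := by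
  simp [markedPositions, Finset.insert_comm]

lemma four_le_of_playable {N : ℕ} {S : Finset (Fin N)} {v : Fin N} {p q : ℕ}
    (hv : Playable (pathGraph N) S v) (h : Consecutive (markedPositions S) p q)
    (hpv : p < v) (hvq : v < q) : 4 ≤ q - p := by
  by_contra! hlt
  obtain ⟨u, hu, hnd⟩ := hv
  obtain ⟨hp, hq, -, -⟩ := h
  have hv := v.2
  have hu2 := u.2
  have hu' : u.val = v ∨ v.val + 1 = u ∨ u.val + 1 = v := by
    rcases hu with rfl | hu
    · exact Or.inl rfl
    · exact Or.inr (pathGraph_adj.mp hu)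
  have key : ∀ t ∈ markedPositions S, t < N →
      ¬ (u.val = t ∨ t + 1 = u.val ∨ u.val + 1 = t) := by
    intro t ht htN hcl
    rcases mem_markedPositions.mp ht with rfl | ⟨h, hS⟩
    · omega
    · refine hnd ⟨_, hS, hcl.imp (fun h => Fin.ext h) fun h => pathGraph_adj.mpr h⟩
  have h1 := key p hp (by omega)
  rcases mem_markedPositions.mp hq with rfl | ⟨hqN, -⟩
  · omega
  · have h2 := key q hq hqN
    omega

lemma playable_of_consecutive {N : ℕ} {S : Finset (Fin N)} {v : Fin N} {p q : ℕ}
    (h : Consecutive (markedPositions S) p q) (hd : p + 4 ≤ q) (hpv : p < v) (hvp : v ≤ p + 3) :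
    Playable (pathGraph N) S v := by
  obtain ⟨hp, hq, -, hmin⟩ := h
  have hqN : q ≤ N + 1 := by
    rcases mem_markedPositions.mp hq with h | ⟨h, -⟩ <;> omega
  refine ⟨⟨p + 2, by omega⟩, ?_, ?_⟩
  · rw [pathGraph_adj, Fin.ext_iff]
    simp only
    omega
  · rintro ⟨s, hs, hsu⟩
    have hs' : s.val = p + 2 ∨ s.val + 1 = p + 2 ∨ p + 2 + 1 = s.val := by
      rcases hsu with h | h
      · exact Or.inl (congrArg Fin.val h).symm
      · exact Or.inr (pathGraph_adj.mp h)
    have := hmin s (mem_markedPositions.mpr (Or.inr ⟨s.2, hs⟩)) (by omega)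
    omega

lemma grundy_pathGraph_eq_gapSum {N : ℕ} (hN : 0 < N) (S : Finset (Fin N))
    (h0 : (⟨0, hN⟩ : Fin N) ∈ S) :
    grundy (pathGraph N) S = gapSum (markedPositions S) := by
  induction hc : (Finset.univ \ S).card using Nat.strong_induction_on generalizing S with
  | _ c ih =>
    subst hc
    have hmove : ∀ v, Playable (pathGraph N) S v →
        grundy (pathGraph N) (insert v S) = gapSum (insert v.val (markedPositions S)) := by
      intro v hv
      rw [← markedPositions_insert]
      exact ih _ hv.card_lt _ (Finset.mem_insert_of_mem h0) rfl
    have hend : N + 1 ∈ markedPositions S := mem_markedPositions.mpr (Or.inl rfl)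
    refine grundy_eq_of (fun v hv => ?_) fun m hm => ?_
    · rw [hmove v hv]
      have hvS : v.val ∉ markedPositions S := by
        intro h
        rcases mem_markedPositions.mp h with h | ⟨_, h⟩
        · have := v.2
          omega
        · exact hv.not_mem h
      have hz : 0 ∈ markedPositions S := mem_markedPositions.mpr (Or.inr ⟨hN, h0⟩)
      have hvpos : 0 < v.val := Nat.pos_of_ne_zero fun h => hvS (h ▸ hz)
      obtain ⟨p, q, hpq, hpv, hvq⟩ :=
        exists_consecutive_of_between hz hend hvpos (by have := v.2; omega) hvS
      rw [gapSum_insert hpq hpv hvq]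
      intro h
      rw [Nat.xor_assoc] at h
      have h' := congrArg (gapSum (markedPositions S) ^^^ ·) h
      simp only [← Nat.xor_assoc, Nat.xor_self, Nat.zero_xor] at h'
      rw [Nat.xor_assoc] at h'
      refine gapValue_split_ne (four_le_of_playable hv hpq hpv hvq)
        (Nat.sub_pos_of_lt hpv) (by omega) ?_
      rw [show q - p - (v.val - p) = q - v by omega]
      exact (Nat.xor_eq_zero_iff.mp h').symm
    · obtain ⟨p, hp, hlt⟩ := exists_xor_lt_of_lt_nimSum _ _ m hm
      change m ^^^ gapSum (markedPositions S) ^^^ _ < _ at hlt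
      have hpN : p < N + 1 := by
        rcases mem_markedPositions.mp hp with rfl | ⟨h, -⟩
        · exfalso
          have : nextElem (markedPositions S) (N + 1) = 0 := by
            rw [nextElem, Nat.sInf_eq_zero]
            right
            ext t
            simp only [mem_markedPositions, Set.mem_ofPred_eq, Set.mem_empty_iff_false, iff_false]
            rintro ⟨h | ⟨h, -⟩, h'⟩ <;> omega
          simp [this, gapValue] at hlt
        · omega
      obtain ⟨q, hpq⟩ := exists_consecutive_of_lt hp hend hpN
      rw [nextElem_eq hpq.2.1 hpq.2.2.1 hpq.2.2.2] at hlt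
      obtain ⟨k, hk0, hk3, hkd, hd, hk⟩ := exists_gapValue_split hlt
      have hqN : q ≤ N + 1 := hpq.2.2.2 _ hend hpN
      have hv : Playable (pathGraph N) S ⟨p + k, by omega⟩ :=
        playable_of_consecutive hpq (by omega) (by simp only; omega) (by simp only; omega)
      refine ⟨_, hv, ?_⟩
      rw [hmove _ hv, gapSum_insert hpq (by simp only; omega) (by simp only; omega)]
      simp only
      rw [show p + k - p = k by omega, show q - (p + k) = q - p - k by omega, hk]
      apply Nat.eq_of_testBit_eq
      intro i
      simp only [Nat.testBit_xor]
      grind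

theorem grundyP'_eq (n : ℕ) (hn : 1 ≤ n) : grundyP' n = n % 4 := by
  have hm : markedPositions {(0 : Fin (n + 2))} = insert 0 {n + 3} := by
    simp [markedPositions, Finset.pair_comm]
  have h0 : nextElem (insert 0 {n + 3}) 0 = n + 3 :=
    nextElem_eq (by simp) (by omega) (by simp)
  have h1 : nextElem (insert 0 {n + 3}) (n + 3) = 0 := by
    rw [nextElem, Nat.sInf_eq_zero]
    right
    ext t
    simp only [Finset.mem_insert, Finset.mem_singleton, Set.mem_ofPred_eq,
      Set.mem_empty_iff_false, iff_false]
    omega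
  rw [grundyP', grundy_pathGraph_eq_gapSum (Nat.succ_pos _) _ (by simp), hm, gapSum,
    nimSum_insert (by simp), nimSum, Finset.fold_singleton, h0, h1]
  simp [gapValue]
end

section
/- For every n ≥ 1, the Grundy value of the position P''_n of the Normal Domination Game is equal to n % 4. -/
open SimpleGraph Finset

/-- The position `P''ₙ`: the path on `n + 4` vertices in which the first and the
last vertices are the only selected vertices. Its Grundy value. -/
noncomputable def grundyP'' (n : ℕ) : ℕ :=
  grundy (SimpleGraph.pathGraph (n + 4)) {(0 : Fin (n + 4)), Fin.last (n + 3)}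

/-- The nim-sum of the lengths modulo `4` of the intervals `[a, b)` listed in `L`. -/
def nimSumRuns (L : List (ℕ × ℕ)) : ℕ :=
  L.foldr (fun p x => ((p.2 - p.1) % 4) ^^^ x) 0

lemma nimSumRuns_cons (p : ℕ × ℕ) (L : List (ℕ × ℕ)) :
    nimSumRuns (p :: L) = ((p.2 - p.1) % 4) ^^^ nimSumRuns L := rfl

lemma List.Perm.nimSumRuns_eq {L L' : List (ℕ × ℕ)} (h : L.Perm L') :
    nimSumRuns L = nimSumRuns L' := by
  induction h with
  | nil => rfl
  | cons p _ ih => rw [nimSumRuns_cons, nimSumRuns_cons, ih]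
  | swap p q L => simp only [nimSumRuns_cons, Nat.xor_left_comm]
  | trans _ _ ih₁ ih₂ => exact ih₁.trans ih₂

/-- A value below a nim-sum can be reached by lowering one of the summands. -/
lemma exists_perm_cons_xor_lt {L : List (ℕ × ℕ)} {y : ℕ} (h : y < nimSumRuns L) :
    ∃ p L', L.Perm (p :: L') ∧ y ^^^ nimSumRuns L' < (p.2 - p.1) % 4 := by
  induction L generalizing y with
  | nil => exact absurd h (Nat.not_lt_zero y)
  | cons p L ih =>
    rw [nimSumRuns_cons] at h
    rcases Nat.lt_xor_cases h with h | h
    · exact ⟨p, L, List.Perm.refl _, h⟩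
    · obtain ⟨q, L', hL, hq⟩ := ih h
      refine ⟨q, p :: L', (hL.cons p).trans (List.Perm.swap q p L'), ?_⟩
      rwa [nimSumRuns_cons, ← Nat.xor_assoc]

/-- The intervals `[a, b)` listed in `L` cover exactly the undominated vertices of the path on
`N` vertices, avoid its two ends, and are at distance at least `3` from each other. -/
structure IsRuns {N : ℕ} (S : Finset (Fin N)) (L : List (ℕ × ℕ)) : Prop where
  bounds : ∀ p ∈ L, 1 ≤ p.1 ∧ p.2 < N
  separated : L.Pairwise fun p q => p.2 + 2 ≤ q.1 ∨ q.2 + 2 ≤ p.1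
  not_dominated_iff : ∀ u : Fin N,
    ¬ Dominated (pathGraph N) S u ↔ ∃ p ∈ L, p.1 ≤ u.val ∧ u.val < p.2

lemma IsRuns.perm {N : ℕ} {S : Finset (Fin N)} {L L' : List (ℕ × ℕ)} (h : IsRuns S L)
    (hL : L.Perm L') : IsRuns S L' where
  bounds p hp := h.bounds p (hL.mem_iff.2 hp)
  separated := (hL.pairwise_iff fun h => h.symm).1 h.separated
  not_dominated_iff u := by simp only [h.not_dominated_iff u, hL.mem_iff]

lemma not_dominated_insert {N : ℕ} {S : Finset (Fin N)} {u v : Fin N} :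
    ¬ Dominated (pathGraph N) (insert v S) u ↔
      ¬ Dominated (pathGraph N) S u ∧ (u.val + 1 < v.val ∨ v.val + 1 < u.val) := by
  have : (u = v ∨ (pathGraph N).Adj v u) ↔ ¬ (u.val + 1 < v.val ∨ v.val + 1 < u.val) := by
    rw [pathGraph_adj, Fin.ext_iff]; omega
  unfold Dominated
  rw [Finset.exists_mem_insert, this, not_or, not_not, and_comm]

/-- Selecting a vertex in the closed neighborhood of a run splits this run in two. -/
lemma IsRuns.insert {N : ℕ} {S : Finset (Fin N)} {p : ℕ × ℕ} {L : List (ℕ × ℕ)}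
    (h : IsRuns S (p :: L)) {v : Fin N} (hv : p.1 ≤ v.val + 1) (hv' : v.val ≤ p.2) :
    IsRuns (insert v S) ((p.1, v.val - 1) :: (v.val + 2, p.2) :: L) where
  bounds q hq := by
    have hp := h.bounds p List.mem_cons_self
    have := v.isLt
    rcases List.mem_cons.1 hq with rfl | hq
    · exact ⟨hp.1, by dsimp only; omega⟩
    rcases List.mem_cons.1 hq with rfl | hq
    · exact ⟨by dsimp only; omega, hp.2⟩
    · exact h.bounds q (List.mem_cons_of_mem p hq)
  separated := by
    have hp := h.bounds p List.mem_cons_self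
    obtain ⟨hsep, hL⟩ := List.pairwise_cons.1 h.separated
    refine List.pairwise_cons.2 ⟨fun q hq => ?_, List.pairwise_cons.2 ⟨fun q hq => ?_, hL⟩⟩
    · rcases List.mem_cons.1 hq with rfl | hq
      · dsimp only; omega
      · have := hsep q hq
        dsimp only; omega
    · have := hsep q hq
      dsimp only; omega
  not_dominated_iff u := by
    have hp := h.bounds p List.mem_cons_self
    have hsep := (List.pairwise_cons.1 h.separated).1
    rw [not_dominated_insert, h.not_dominated_iff]
    simp only [List.exists_mem_cons_iff]
    constructor
    · rintro ⟨hu | hu, huv⟩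
      · by_cases huv' : u.val + 1 < v.val
        · left; omega
        · right; left; omega
      · exact Or.inr (Or.inr hu)
    · rintro (hu | hu | ⟨q, hq, hu⟩)
      · exact ⟨Or.inl (by omega), by omega⟩
      · exact ⟨Or.inl (by omega), by omega⟩
      · refine ⟨Or.inr ⟨q, hq, hu⟩, ?_⟩
        have := hsep q hq
        omega

lemma IsRuns.playable_iff {N : ℕ} {S : Finset (Fin N)} {L : List (ℕ × ℕ)} (h : IsRuns S L)
    (v : Fin N) :
    Playable (pathGraph N) S v ↔ ∃ p ∈ L, p.1 < p.2 ∧ p.1 ≤ v.val + 1 ∧ v.val ≤ p.2 := by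
  constructor
  · rintro ⟨u, huv, hu⟩
    obtain ⟨p, hp, hpu⟩ := (h.not_dominated_iff u).1 hu
    refine ⟨p, hp, ?_⟩
    rw [pathGraph_adj, Fin.ext_iff] at huv
    omega
  · rintro ⟨p, hp, hlt, hv, hv'⟩
    have hb := h.bounds p hp
    obtain ⟨w, hw, hw'⟩ : ∃ w, (p.1 ≤ w ∧ w < p.2) ∧
        (w = v.val ∨ v.val + 1 = w ∨ w + 1 = v.val) := by
      by_cases h₁ : v.val < p.1
      · exact ⟨p.1, by omega, by omega⟩
      by_cases h₂ : v.val < p.2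
      · exact ⟨v.val, by omega, by omega⟩
      · exact ⟨p.2 - 1, by omega, by omega⟩
    refine ⟨⟨w, by omega⟩, ?_, (h.not_dominated_iff _).2 ⟨p, hp, hw⟩⟩
    rw [pathGraph_adj, Fin.ext_iff]
    exact hw'

/-- Splitting a run changes its length modulo `4`, as a nim-value. -/
lemma xor_mod_four_ne {a b v : ℕ} (hab : a < b) (hv : a ≤ v + 1) (hv' : v ≤ b) :
    ((v - 1 - a) % 4) ^^^ ((b - (v + 2)) % 4) ≠ (b - a) % 4 := by
  by_cases h₁ : v ≤ a + 1
  · have : v - 1 - a = 0 := by omega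
    rw [this, Nat.zero_mod, Nat.zero_xor]
    omega
  by_cases h₂ : b ≤ v + 2
  · have : b - (v + 2) = 0 := by omega
    rw [this, Nat.zero_mod, Nat.xor_zero]
    omega
  intro h
  have := congrArg (· % 2) h
  simp only [Nat.xor_mod_two_eq] at this
  omega

lemma eq_sInf_notMem_range {ι : Type} {f : ι → ℕ} {x : ℕ} (hx : ∀ i, f i ≠ x)
    (hlt : ∀ y < x, ∃ i, f i = y) : sInf {m : ℕ | m ∉ Set.range f} = x := by
  have hmem : x ∈ {m : ℕ | m ∉ Set.range f} := fun ⟨i, hi⟩ => hx i hi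
  refine le_antisymm (Nat.sInf_le hmem) (not_lt.1 fun h => ?_)
  exact Nat.sInf_mem ⟨x, hmem⟩ (hlt _ h)

/-- A position on a path whose undominated vertices form separated runs has as Grundy value the
nim-sum of the lengths of these runs modulo `4`. -/
theorem IsRuns.grundy_eq {N : ℕ} (S : Finset (Fin N)) (L : List (ℕ × ℕ)) (h : IsRuns S L) :
    grundy (pathGraph N) S = nimSumRuns L := by
  induction hc : (Finset.univ \ S).card using Nat.strong_induction_on generalizing S L with
  | _ c ih =>
  subst hc
  rw [grundy]
  apply eq_sInf_notMem_range
  · rintro ⟨v, hpv⟩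
    obtain ⟨p, hp, hlt, hv, hv'⟩ := (h.playable_iff v).1 hpv
    have hperm := List.perm_cons_erase hp
    have hins := (h.perm hperm).insert hv hv'
    dsimp only
    rw [ih _ hpv.card_lt _ _ hins rfl, hperm.nimSumRuns_eq]
    simp only [nimSumRuns_cons]
    rw [← Nat.xor_assoc]
    intro heq
    exact xor_mod_four_ne hlt hv hv' (Nat.xor_left_injective heq)
  · intro y hy
    obtain ⟨p, L', hperm, hlt⟩ := exists_perm_cons_xor_lt hy
    have hp : p ∈ L := hperm.mem_iff.2 List.mem_cons_self
    have hb := h.bounds p hp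
    set z := y ^^^ nimSumRuns L' with hz
    obtain ⟨v, hv⟩ : ∃ v : Fin N, v.val + 2 + z = p.1 + (p.2 - p.1) % 4 :=
      ⟨⟨p.1 + (p.2 - p.1) % 4 - 2 - z, by omega⟩, by dsimp only; omega⟩
    have hpv : Playable (pathGraph N) S v :=
      (h.playable_iff v).2 ⟨p, hp, by omega, by omega, by omega⟩
    refine ⟨⟨v, hpv⟩, ?_⟩
    have hins := (h.perm hperm).insert (v := v) (by omega) (by omega)
    dsimp only
    rw [ih _ hpv.card_lt _ _ hins rfl]
    have hleft : (v.val - 1 - p.1) % 4 = 0 := by omega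
    have hright : (p.2 - (v.val + 2)) % 4 = z := by omega
    simp only [nimSumRuns_cons]
    rw [hleft, hright, hz, Nat.zero_xor, Nat.xor_assoc, Nat.xor_self, Nat.xor_zero]

lemma isRuns_ends (n : ℕ) :
    IsRuns {(0 : Fin (n + 4)), Fin.last (n + 3)} [(2, n + 2)] where
  bounds := by simp
  separated := List.pairwise_singleton _ _
  not_dominated_iff u := by
    have hempty : Dominated (pathGraph (n + 4)) ∅ u ↔ False := by simp [Dominated]
    rw [not_dominated_insert, ← insert_empty_eq, not_dominated_insert, hempty]
    simp only [List.mem_singleton, exists_eq_left, Fin.val_zero, Fin.val_last, not_false_eq_true,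
      true_and]
    have := u.isLt
    omega

theorem grundyP''_eq (n : ℕ) (hn : 1 ≤ n) : grundyP'' n = n % 4 := by
  rw [grundyP'', (isRuns_ends n).grundy_eq]
  simp [nimSumRuns]
end

section
/- In the Normal Domination Game, the Grundy values of the paths P_1, P_2 and P_3 are 1, 1 and 2, respectively; moreover, for every n ≥ 4, the Grundy value of P_n equals 0 if n % 4 = 0, equals 1 if n % 4 = 1, equals 1 if n % 4 = 2, and equals 3 if n % 4 = 3. -/
open SimpleGraph Finset

lemma Dominated.insert {V : Type} [DecidableEq V] {G : SimpleGraph V} {S : Finset V} {u : V}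
    (h : Dominated G S u) (w : V) :
    Dominated G (insert w S) u := by
  obtain ⟨s, hs, hu⟩ := h
  exact ⟨s, Finset.mem_insert_of_mem hs, hu⟩

lemma dominated_insert {V : Type} [DecidableEq V] {G : SimpleGraph V} {S : Finset V}
    {u w : V} :
    Dominated G (insert w S) u ↔ (u = w ∨ G.Adj w u) ∨ Dominated G S u := by
  simp [Dominated]

section Region

variable {V : Type} [Fintype V] [DecidableEq V] {G : SimpleGraph V}

/-- The Grundy value of the game in which both players may only select vertices of `R`. -/
noncomputable def regionGrundy {V : Type} [Fintype V] [DecidableEq V] (G : SimpleGraph V)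
    (R : Set V) (S : Finset V) : ℕ :=
  sInf {m : ℕ |
    m ∉ Set.range fun v : {v : V // Playable G S v ∧ v ∈ R} => regionGrundy G R (insert v.1 S)}
termination_by (Finset.univ \ S).card
decreasing_by exact v.2.1.card_lt

lemma regionGrundy_ne {R : Set V} {S : Finset V} {v : V} (hv : Playable G S v) (hR : v ∈ R) :
    regionGrundy G R (insert v S) ≠ regionGrundy G R S := by
  intro h
  rw [regionGrundy.eq_def G R S] at h
  have hne : {m : ℕ | m ∉ Set.range fun v : {v : V // Playable G S v ∧ v ∈ R} =>
      regionGrundy G R (insert v.1 S)}.Nonempty :=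
    (Set.finite_range _).infinite_compl.nonempty
  exact Nat.sInf_mem hne ⟨⟨v, hv, hR⟩, h⟩

lemma exists_regionGrundy_eq {R : Set V} {S : Finset V} {k : ℕ} (hk : k < regionGrundy G R S) :
    ∃ v, Playable G S v ∧ v ∈ R ∧ regionGrundy G R (insert v S) = k := by
  rw [regionGrundy.eq_def G R S] at hk
  have := Nat.notMem_of_lt_sInf hk
  simp only [Set.mem_ofPred_eq, not_not] at this
  obtain ⟨⟨v, hv, hR⟩, h⟩ := this
  exact ⟨v, hv, hR, h⟩

lemma regionGrundy_eq_of {R : Set V} {S : Finset V} {m : ℕ}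
    (hne : ∀ v, Playable G S v → v ∈ R → regionGrundy G R (insert v S) ≠ m)
    (hex : ∀ k < m, ∃ v, Playable G S v ∧ v ∈ R ∧ regionGrundy G R (insert v S) = k) :
    regionGrundy G R S = m := by
  rcases lt_trichotomy (regionGrundy G R S) m with h | h | h
  · obtain ⟨v, hv, hR, hvm⟩ := hex _ h
    exact absurd hvm (regionGrundy_ne hv hR)
  · exact h
  · obtain ⟨v, hv, hR, hvm⟩ := exists_regionGrundy_eq h
    exact absurd hvm (hne v hv hR)

lemma grundy_eq_regionGrundy_univ (S : Finset V) :
    grundy G S = regionGrundy G Set.univ S := by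
  induction hc : (Finset.univ \ S).card using Nat.strong_induction_on generalizing S with
  | _ c ih =>
    subst hc
    rw [grundy, regionGrundy]
    congr 1
    ext m
    have key : ∀ v, Playable G S v →
        grundy G (insert v S) = regionGrundy G Set.univ (insert v S) :=
      fun v hv => ih _ hv.card_lt _ rfl
    simp only [Set.mem_ofPred_eq, Set.mem_range, not_iff_not]
    constructor
    · rintro ⟨⟨v, hv⟩, rfl⟩
      exact ⟨⟨v, hv, trivial⟩, (key v hv).symm⟩
    · rintro ⟨⟨v, hv, -⟩, rfl⟩
      exact ⟨⟨v, hv⟩, key v hv⟩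

lemma regionGrundy_insert_of_separated {R : Set V} {w : V} (S : Finset V)
    (h : ∀ v ∈ R, ∀ u, (u = v ∨ G.Adj v u) → (u = w ∨ G.Adj w u) → Dominated G S u) :
    regionGrundy G R (insert w S) = regionGrundy G R S := by
  induction hc : (Finset.univ \ S).card using Nat.strong_induction_on generalizing S with
  | _ c ih =>
    subst hc
    have hplay : ∀ v ∈ R, (Playable G (insert w S) v ↔ Playable G S v) := by
      intro v hv
      constructor
      · rintro ⟨u, hu, hd⟩
        exact ⟨u, hu, fun hd' => hd (hd'.insert w)⟩
      · rintro ⟨u, hu, hd⟩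
        refine ⟨u, hu, fun hd' => ?_⟩
        rcases dominated_insert.1 hd' with h' | h'
        · exact hd (h v hv u hu h')
        · exact hd h'
    have key : ∀ v, Playable G S v →
        regionGrundy G R (insert v (insert w S)) = regionGrundy G R (insert v S) := by
      intro v hv
      rw [Finset.insert_comm]
      exact ih _ hv.card_lt _ (fun x hx u hu hw => (h x hx u hu hw).insert v) rfl
    refine regionGrundy_eq_of (fun v hv hR => ?_) (fun k hk => ?_)
    · rw [hplay v hR] at hv
      rw [key v hv]
      exact regionGrundy_ne hv hR
    · obtain ⟨v, hv, hR, rfl⟩ := exists_regionGrundy_eq hk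
      exact ⟨v, (hplay v hR).2 hv, hR, key v hv⟩

/-- The Grundy value of a region made of two parts that share no undominated vertex in the closed
neighborhoods of their vertices is the nim-sum of the Grundy values of the parts. -/
lemma regionGrundy_eq_xor {R R₁ R₂ : Set V} (S : Finset V) (h₁ : R₁ ⊆ R) (h₂ : R₂ ⊆ R)
    (hcover : ∀ v ∈ R, Playable G S v → v ∈ R₁ ∨ v ∈ R₂)
    (hsep : ∀ v ∈ R₁, ∀ w ∈ R₂, ∀ u, (u = v ∨ G.Adj v u) → (u = w ∨ G.Adj w u) →
      Dominated G S u) :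
    regionGrundy G R S = regionGrundy G R₁ S ^^^ regionGrundy G R₂ S := by
  induction hc : (Finset.univ \ S).card using Nat.strong_induction_on generalizing S with
  | _ c ih =>
    subst hc
    have step : ∀ v, Playable G S v → regionGrundy G R (insert v S) =
        regionGrundy G R₁ (insert v S) ^^^ regionGrundy G R₂ (insert v S) := by
      intro v hv
      refine ih _ hv.card_lt _ (fun x hx hpx => hcover x hx ?_)
        (fun x hx y hy u hu hw => (hsep x hx y hy u hu hw).insert v) rfl
      obtain ⟨u, hu, hd⟩ := hpx
      exact ⟨u, hu, fun hd' => hd (hd'.insert v)⟩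
    have left : ∀ v, Playable G S v → v ∈ R₁ → regionGrundy G R (insert v S) =
        regionGrundy G R₁ (insert v S) ^^^ regionGrundy G R₂ S := by
      intro v hv hR
      rw [step v hv, regionGrundy_insert_of_separated (R := R₂) S
        (fun x hx u hu hw => hsep v hR x hx u hw hu)]
    have right : ∀ v, Playable G S v → v ∈ R₂ → regionGrundy G R (insert v S) =
        regionGrundy G R₁ S ^^^ regionGrundy G R₂ (insert v S) := by
      intro v hv hR
      rw [step v hv, regionGrundy_insert_of_separated (R := R₁) S
        (fun x hx u hu hw => hsep x hx v hR u hu hw)]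
    refine regionGrundy_eq_of (fun v hv hR => ?_) (fun k hk => ?_)
    · rcases hcover v hR hv with h | h
      · rw [left v hv h]
        exact fun he => regionGrundy_ne hv h (Nat.xor_left_injective he)
      · rw [right v hv h]
        exact fun he => regionGrundy_ne hv h (Nat.xor_right_injective he)
    · rcases Nat.lt_xor_cases hk with h | h
      · obtain ⟨v, hv, hR, he⟩ := exists_regionGrundy_eq h
        exact ⟨v, hv, h₁ hR, by rw [left v hv hR, he, Nat.xor_assoc, Nat.xor_self, Nat.xor_zero]⟩
      · obtain ⟨v, hv, hR, he⟩ := exists_regionGrundy_eq h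
        refine ⟨v, hv, h₂ hR, ?_⟩
        rw [right v hv hR, he, Nat.xor_comm k, ← Nat.xor_assoc, Nat.xor_self, Nat.zero_xor]

end Region

/-- The Grundy value of a run of `h` unselected consecutive vertices of a path; the flags tell
whether the run is followed by a selected vertex on its left and on its right. -/
def gapGrundy : Bool → Bool → ℕ → ℕ
  | true, true, h => if h < 2 then 0 else (h - 2) % 4
  | true, false, h => if h = 0 then 0 else (h - 1) % 4
  | false, true, h => if h = 0 then 0 else (h - 1) % 4
  | false, false, h =>
    if h = 3 then 2
    else if h % 4 = 0 then 0
    else if h % 4 = 1 then 1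
    else if h % 4 = 2 then 1
    else 3

lemma xor_mod_two_of_lt_four {x y : ℕ} (hx : x < 4) (hy : y < 4) :
    (x ^^^ y) % 2 = (x + y) % 2 := by
  interval_cases x <;> interval_cases y <;> rfl

lemma xor_of_add_mod_four_eq_three {x y : ℕ} (hx : x < 4) (hy : y < 4) (h : (x + y) % 4 = 3) :
    x ^^^ y = 3 := by
  interval_cases x <;> interval_cases y <;> first | rfl | omega

lemma gapGrundy_lt_four (l r : Bool) (h : ℕ) : gapGrundy l r h < 4 := by
  cases l <;> cases r <;> simp only [gapGrundy] <;> split_ifs <;> omega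

lemma gapGrundy_comm (l r : Bool) (h : ℕ) : gapGrundy l r h = gapGrundy r l h := by
  cases l <;> cases r <;> rfl

lemma gapGrundy_xor_ne {l r : Bool} {i j : ℕ} (h : l.toNat + r.toNat < i + j + 1) :
    gapGrundy l true i ^^^ gapGrundy true r j ≠ gapGrundy l r (i + j + 1) := by
  have hi := gapGrundy_lt_four l true i
  have hj := gapGrundy_lt_four true r j
  have hpar := xor_mod_two_of_lt_four hi hj
  have hthree := xor_of_add_mod_four_eq_three hi hj
  intro he
  rw [he] at hpar hthree
  by_cases hi0 : gapGrundy l true i = 0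
  · rw [hi0, Nat.zero_xor] at he
    revert he hpar hthree hi0
    cases l <;> cases r <;> simp only [gapGrundy, Bool.toNat_true, Bool.toNat_false] at h ⊢ <;>
      split_ifs <;> intros <;> omega
  by_cases hj0 : gapGrundy true r j = 0
  · rw [hj0, Nat.xor_zero] at he
    revert he hpar hthree hj0
    cases l <;> cases r <;> simp only [gapGrundy, Bool.toNat_true, Bool.toNat_false] at h ⊢ <;>
      split_ifs <;> intros <;> omega
  revert he hpar hthree hi0 hj0
  cases l <;> cases r <;> simp only [gapGrundy, Bool.toNat_true, Bool.toNat_false] at h ⊢ <;>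
    split_ifs <;> intros <;> omega

lemma gapGrundy_pos_imp {l r : Bool} {h : ℕ} (hpos : 0 < gapGrundy l r h) :
    l.toNat + r.toNat < h := by
  revert hpos
  cases l <;> cases r <;> simp only [gapGrundy, Bool.toNat_true, Bool.toNat_false] <;>
    split_ifs <;> omega

lemma exists_gapGrundy_true_xor_eq {r : Bool} {h k : ℕ} (hk : k < gapGrundy true r h) :
    ∃ i j, i + j + 1 = h ∧ gapGrundy true true i ^^^ gapGrundy true r j = k := by
  have hlt := gapGrundy_lt_four true r h
  have hpos := gapGrundy_pos_imp (Nat.zero_lt_of_lt hk)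
  have hi : gapGrundy true true (gapGrundy true r h - 1 - k) = 0 := by
    simp only [gapGrundy.eq_1 (gapGrundy true r h - 1 - k)]
    split_ifs <;> omega
  refine ⟨gapGrundy true r h - 1 - k, h - 1 - (gapGrundy true r h - 1 - k), ?_, ?_⟩
  · revert hk
    cases r <;> simp only [gapGrundy, Bool.toNat_true, Bool.toNat_false] at hpos ⊢ <;>
      split_ifs <;> omega
  · rw [hi, Nat.zero_xor]
    clear hi
    revert hk
    cases r <;> simp only [gapGrundy, Bool.toNat_true, Bool.toNat_false] at hpos ⊢ <;>
      split_ifs <;> omega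

lemma exists_gapGrundy_xor_eq {l r : Bool} {h k : ℕ} (hk : k < gapGrundy l r h) :
    ∃ i j, i + j + 1 = h ∧ gapGrundy l true i ^^^ gapGrundy true r j = k := by
  cases l with
  | true => exact exists_gapGrundy_true_xor_eq hk
  | false =>
    cases r with
    | true =>
      rw [gapGrundy_comm] at hk
      obtain ⟨i, j, hij, he⟩ := exists_gapGrundy_true_xor_eq hk
      exact ⟨j, i, by omega, by rw [Nat.xor_comm, gapGrundy_comm false true j]; exact he⟩
    | false =>
      have cases_k : (k = 0 ∧ h = 1) ∨ (k = 0 ∧ h % 4 = 1 ∧ 5 ≤ h) ∨ (k = 0 ∧ h % 4 = 2) ∨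
          (k = 0 ∧ h % 4 = 3) ∨ (k = 1 ∧ h % 4 = 3) ∨ (k = 2 ∧ h % 4 = 3 ∧ 7 ≤ h) := by
        simp only [gapGrundy] at hk
        split_ifs at hk <;> omega
      have one_xor : ∀ j m, gapGrundy true false j = m →
          gapGrundy false true 2 ^^^ gapGrundy true false j = 1 ^^^ m := by
        rintro j m rfl
        rfl
      have zero_xor : ∀ i j, i ≤ 1 →
          gapGrundy false true i ^^^ gapGrundy true false j = gapGrundy true false j := by
        intro i j hi
        interval_cases i <;> simp [gapGrundy]
      rcases cases_k with ⟨rfl, h'⟩ | ⟨rfl, h', h5⟩ | ⟨rfl, h'⟩ | ⟨rfl, h'⟩ | ⟨rfl, h'⟩ |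
        ⟨rfl, h', h7⟩
      · exact ⟨0, 0, by omega, rfl⟩
      · refine ⟨2, h - 3, by omega, one_xor _ 1 ?_⟩
        simp only [gapGrundy]
        split_ifs <;> omega
      · refine ⟨0, h - 1, by omega, (zero_xor _ _ (by omega)).trans ?_⟩
        simp only [gapGrundy]
        split_ifs <;> omega
      · refine ⟨1, h - 2, by omega, (zero_xor _ _ (by omega)).trans ?_⟩
        simp only [gapGrundy]
        split_ifs <;> omega
      · refine ⟨0, h - 1, by omega, (zero_xor _ _ (by omega)).trans ?_⟩
        simp only [gapGrundy]
        split_ifs <;> omega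
      · refine ⟨2, h - 3, by omega, one_xor _ 3 ?_⟩
        simp only [gapGrundy]
        split_ifs <;> omega

/-- The vertices `a, …, a + h - 1` of the path form a maximal run of unselected vertices, preceded
(resp. followed) by a selected vertex when `l` (resp. `r`) is `true`, and by nothing otherwise. -/
structure IsGap {n : ℕ} (S : Finset (Fin n)) (l r : Bool) (a h : ℕ) : Prop where
  le : a + h ≤ n
  left : if l then ∃ s ∈ S, s.val + 1 = a else a = 0
  right : if r then ∃ s ∈ S, s.val = a + h else a + h = n
  notMem : ∀ s ∈ S, ¬ (a ≤ s.val ∧ s.val < a + h)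

section Gap

variable {n : ℕ} {S : Finset (Fin n)} {l r : Bool} {a h : ℕ}

lemma eq_or_pathGraph_adj_iff {u v : Fin n} :
    (u = v ∨ (pathGraph n).Adj v u) ↔ u.val ≤ v.val + 1 ∧ v.val ≤ u.val + 1 := by
  rw [pathGraph_adj, Fin.ext_iff]
  omega

lemma IsGap.not_dominated_iff (hg : IsGap S l r a h) {u : Fin n} (ha : a ≤ u.val + 1)
    (hu : u.val ≤ a + h) :
    ¬ Dominated (pathGraph n) S u ↔ a + l.toNat ≤ u.val ∧ u.val + r.toNat < a + h := by
  obtain ⟨hle, hl, hr, hS⟩ := hg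
  have hd : Dominated (pathGraph n) S u ↔
      ∃ s ∈ S, u.val ≤ s.val + 1 ∧ s.val ≤ u.val + 1 := by
    simp only [Dominated, eq_or_pathGraph_adj_iff]
  rw [hd]
  have hun := u.isLt
  constructor
  · intro hnd
    push Not at hnd
    constructor
    · cases l with
      | false => simp at hl ⊢; omega
      | true =>
        simp only [if_true, Bool.toNat_true] at hl ⊢
        obtain ⟨s, hs, rfl⟩ := hl
        have := hnd s hs
        omega
    · cases r with
      | false => simp at hr ⊢; omega
      | true =>
        simp only [if_true, Bool.toNat_true] at hr ⊢
        obtain ⟨s, hs, hsa⟩ := hr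
        have := hnd s hs
        omega
  · rintro ⟨h1, h2⟩ ⟨s, hs, h3, h4⟩
    have h5 := hS s hs
    have hsn := s.isLt
    rcases lt_or_ge s.val a with h6 | h6
    · cases l with
      | false => simp at hl; omega
      | true =>
        simp only [Bool.toNat_true] at h1
        omega
    · cases r with
      | false => simp at hr; omega
      | true =>
        simp only [Bool.toNat_true] at h2
        omega

lemma IsGap.playable_iff (hg : IsGap S l r a h) {v : Fin n} (ha : a ≤ v.val)
    (hv : v.val < a + h) :
    Playable (pathGraph n) S v ↔ l.toNat + r.toNat < h := by
  have hln := l.toNat_le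
  have hrn := r.toNat_le
  have hle := hg.le
  simp only [Playable, eq_or_pathGraph_adj_iff]
  constructor
  · rintro ⟨u, hu, hd⟩
    rw [hg.not_dominated_iff (by omega) (by omega)] at hd
    omega
  · intro hlt
    obtain ⟨u, hu1, hu2, hu3, hu4⟩ : ∃ u, u ≤ v.val + 1 ∧ v.val ≤ u + 1 ∧
        a + l.toNat ≤ u ∧ u + r.toNat < a + h := by
      by_cases h1 : v.val < a + l.toNat
      · exact ⟨v + 1, by omega, by omega, by omega, by omega⟩
      by_cases h2 : v.val + r.toNat < a + h
      · exact ⟨v, by omega, by omega, by omega, by omega⟩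
      · exact ⟨v - 1, by omega, by omega, by omega, by omega⟩
    refine ⟨⟨u, by omega⟩, ⟨hu1, hu2⟩, ?_⟩
    rw [hg.not_dominated_iff (by simp only; omega) (by simp only; omega)]
    exact ⟨hu3, hu4⟩

lemma IsGap.insert_left {v : Fin n} {i j : ℕ} (hg : IsGap S l r a (i + j + 1))
    (hv : v.val = a + i) : IsGap (insert v S) l true a i := by
  obtain ⟨hle, hl, hr, hS⟩ := hg
  refine ⟨by omega, ?_, ?_, ?_⟩
  · cases l with
    | false => simpa using hl
    | true =>
      simp only [if_true] at hl ⊢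
      obtain ⟨s, hs, h⟩ := hl
      exact ⟨s, Finset.mem_insert_of_mem hs, h⟩
  · simp only [if_true]
    exact ⟨v, Finset.mem_insert_self _ _, hv⟩
  · intro s hs
    rcases Finset.mem_insert.1 hs with rfl | hs
    · omega
    · have := hS s hs
      omega

lemma IsGap.insert_right {v : Fin n} {i j : ℕ} (hg : IsGap S l r a (i + j + 1))
    (hv : v.val = a + i) : IsGap (insert v S) true r (a + i + 1) j := by
  obtain ⟨hle, hl, hr, hS⟩ := hg
  refine ⟨by omega, ?_, ?_, ?_⟩
  · simp only [if_true]
    exact ⟨v, Finset.mem_insert_self _ _, by omega⟩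
  · cases r with
    | false => simp at hr ⊢; omega
    | true =>
      simp only [if_true] at hr ⊢
      obtain ⟨s, hs, h⟩ := hr
      exact ⟨s, Finset.mem_insert_of_mem hs, by omega⟩
  · intro s hs
    rcases Finset.mem_insert.1 hs with rfl | hs
    · omega
    · have := hS s hs
      omega

lemma IsGap.regionGrundy_eq (hg : IsGap S l r a h) :
    regionGrundy (pathGraph n) {v | a ≤ v.val ∧ v.val < a + h} S = gapGrundy l r h := by
  induction h using Nat.strong_induction_on generalizing S l r a with
  | _ h ih =>
    have option : ∀ (v : Fin n) (i j : ℕ), i + j + 1 = h → v.val = a + i →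
        regionGrundy (pathGraph n) {v | a ≤ v.val ∧ v.val < a + h} (insert v S) =
          gapGrundy l true i ^^^ gapGrundy true r j := by
      rintro v i j rfl hv
      rw [← ih i (by omega) (hg.insert_left hv), ← ih j (by omega) (hg.insert_right hv)]
      apply regionGrundy_eq_xor
      · intro x hx
        simp only [Set.mem_ofPred_eq] at hx ⊢
        omega
      · intro x hx
        simp only [Set.mem_ofPred_eq] at hx ⊢
        omega
      · intro x hx hp
        have hxv : x.val ≠ v.val := fun he =>
          hp.not_mem (Fin.ext he ▸ Finset.mem_insert_self _ _)
        simp only [Set.mem_ofPred_eq] at hx ⊢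
        omega
      · intro x hx y hy u hux huy
        rw [eq_or_pathGraph_adj_iff] at hux huy
        simp only [Set.mem_ofPred_eq] at hx hy
        exact ⟨v, Finset.mem_insert_self _ _, eq_or_pathGraph_adj_iff.2 (by omega)⟩
    have hle := hg.le
    refine regionGrundy_eq_of (fun v hp hv => ?_) (fun k hk => ?_)
    · obtain ⟨hv1, hv2⟩ := hv
      rw [hg.playable_iff hv1 hv2] at hp
      obtain ⟨i, hi⟩ := Nat.exists_eq_add_of_le hv1
      obtain ⟨j, rfl⟩ : ∃ j, h = i + j + 1 := ⟨h - i - 1, by omega⟩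
      rw [option v i j rfl hi]
      exact gapGrundy_xor_ne hp
    · obtain ⟨i, j, hij, he⟩ := exists_gapGrundy_xor_eq hk
      refine ⟨⟨a + i, by omega⟩, ?_, ⟨by simp, by simp only; omega⟩, ?_⟩
      · rw [hg.playable_iff (by simp) (by simp only; omega)]
        exact gapGrundy_pos_imp (Nat.zero_lt_of_lt hk)
      · rw [option _ i j hij rfl, he]

end Gap

lemma grundy_pathGraph_empty (n : ℕ) :
    grundy (pathGraph n) ∅ = gapGrundy false false n := by
  have hg : IsGap (∅ : Finset (Fin n)) false false 0 n := ⟨by simp, by simp, by simp, by simp⟩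
  rw [grundy_eq_regionGrundy_univ, ← hg.regionGrundy_eq]
  congr 1
  ext v
  simp

theorem grundy_path (n : ℕ) :
    grundy (SimpleGraph.pathGraph 1) ∅ = 1 ∧
    grundy (SimpleGraph.pathGraph 2) ∅ = 1 ∧
    grundy (SimpleGraph.pathGraph 3) ∅ = 2 ∧
    (4 ≤ n →
      grundy (SimpleGraph.pathGraph n) ∅ =
        if n % 4 = 0 then 0
        else if n % 4 = 1 then 1
        else if n % 4 = 2 then 1
        else 3) := by
  simp only [grundy_pathGraph_empty]
  refine ⟨rfl, rfl, rfl, fun hn => ?_⟩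
  rw [gapGrundy, if_neg (by omega)]
end

section
/- For every n ≥ 1, the second player (Bob) has a winning strategy in the Normal Domination Game on the path P_n if and only if n is a multiple of 4; equivalently, the first player (Alice) wins on P_n if and only if n % 4 ≠ 0. -/
open SimpleGraph Finset

/-- The player to move in position `S` has a winning strategy (normal play:
the last player to move wins): some move leads to a position in which the
opponent, now to move, has no winning strategy. -/
def FirstWins {V : Type} [Fintype V] [DecidableEq V]
    (G : SimpleGraph V) (S : Finset V) : Prop :=
  ∃ v : V, ∃ _ : Playable G S v, ¬ FirstWins G (insert v S)
termination_by (Finset.univ \ S).card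
decreasing_by exact Playable.card_lt ‹Playable G S v›

/-- Scan the `m` positions `a, …, a + m - 1` of the indicator function `u`, starting inside a run
of length `r`, and take the bitwise XOR of the lengths modulo 4 of the maximal runs met. -/
def runXor (u : ℕ → Bool) : ℕ → ℕ → ℕ → ℕ
  | r, _, 0 => r % 4
  | r, a, m + 1 => if u a then runXor u (r + 1) (a + 1) m else (r % 4) ^^^ runXor u 0 (a + 1) m

lemma runXor_succ_true {u : ℕ → Bool} {a : ℕ} (h : u a = true) (r m : ℕ) :
    runXor u r a (m + 1) = runXor u (r + 1) (a + 1) m := by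
  simp [runXor, h]

lemma runXor_succ_false {u : ℕ → Bool} {a : ℕ} (h : u a = false) (r m : ℕ) :
    runXor u r a (m + 1) = (r % 4) ^^^ runXor u 0 (a + 1) m := by
  simp [runXor, h]

lemma runXor_lt (u : ℕ → Bool) (m : ℕ) : ∀ r a, runXor u r a m < 4 := by
  induction m with
  | zero => intro r a; simp only [runXor]; omega
  | succ m ih =>
    intro r a
    simp only [runXor]
    split
    · exact ih _ _
    · exact Nat.xor_lt_two_pow (n := 2) (by omega) (ih _ _)

lemma runXor_congr {u u' : ℕ → Bool} (m : ℕ) : ∀ r a,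
    (∀ i, a ≤ i → i < a + m → u i = u' i) → runXor u r a m = runXor u' r a m := by
  induction m with
  | zero => intro r a _; rfl
  | succ m ih =>
    intro r a h
    simp only [runXor]
    rw [h a le_rfl (by omega), ih (r + 1) (a + 1) fun i h1 h2 => h i (by omega) (by omega),
      ih 0 (a + 1) fun i h1 h2 => h i (by omega) (by omega)]

lemma runXor_append {u : ℕ → Bool} (m m' : ℕ) : ∀ r a, u (a + m) = false →
    runXor u r a (m + 1 + m') = runXor u r a m ^^^ runXor u 0 (a + m + 1) m' := by
  induction m with
  | zero =>
    intro r a h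
    rw [show 0 + 1 + m' = m' + 1 by omega, runXor_succ_false (by simpa using h)]
    rfl
  | succ m ih =>
    intro r a h
    have h' : u (a + 1 + m) = false := by rw [← h]; congr 1; omega
    rw [show m + 1 + 1 + m' = (m + 1 + m') + 1 by omega]
    simp only [runXor]
    rw [ih _ _ h', ih _ _ h', show a + 1 + m + 1 = a + (m + 1) + 1 by omega]
    split
    · rfl
    · rw [Nat.xor_assoc]

lemma runXor_true {u : ℕ → Bool} (k m : ℕ) : ∀ r a,
    (∀ i, a ≤ i → i < a + k → u i = true) →
    runXor u r a (k + m) = runXor u (r + k) (a + k) m := by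
  induction k with
  | zero => intro r a _; simp
  | succ k ih =>
    intro r a h
    rw [show k + 1 + m = (k + m) + 1 by omega, runXor_succ_true (h a le_rfl (by omega)),
      ih _ _ fun i h1 h2 => h i (by omega) (by omega)]
    congr 1 <;> omega

lemma runXor_false {u : ℕ → Bool} (m : ℕ) : ∀ r a,
    (∀ i, a ≤ i → i < a + m → u i = false) → runXor u r a m = r % 4 := by
  induction m with
  | zero => intro r a _; rfl
  | succ m ih =>
    intro r a h
    rw [runXor_succ_false (h a le_rfl (by omega)),
      ih _ _ fun i h1 h2 => h i (by omega) (by omega)]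
    simp

lemma runXor_false_append {u : ℕ → Bool} (d m : ℕ) : ∀ a,
    (∀ i, a ≤ i → i < a + d → u i = false) →
    runXor u 0 a (d + m) = runXor u 0 (a + d) m := by
  induction d with
  | zero => intro a _; simp
  | succ d ih =>
    intro a h
    rw [show d + 1 + m = (d + m) + 1 by omega, runXor_succ_false (h a le_rfl (by omega)),
      ih _ fun i h1 h2 => h i (by omega) (by omega), show a + 1 + d = a + (d + 1) by omega]
    simp

/-- A single run between positions that are not in any run. -/
lemma runXor_single {u : ℕ → Bool} {a d k m N : ℕ} (hN : d + (k + m) = N)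
    (h1 : ∀ i, a ≤ i → i < a + d → u i = false)
    (h2 : ∀ i, a + d ≤ i → i < a + d + k → u i = true)
    (h3 : ∀ i, a + d + k ≤ i → i < a + N → u i = false) :
    runXor u 0 a N = k % 4 := by
  subst hN
  rw [runXor_false_append d _ a h1, runXor_true k m _ _ h2,
    runXor_false m _ _ fun i h h' => h3 i h (by omega), Nat.zero_add]

/-- The dependence of `runXor` on a suffix. -/
lemma exists_runXor_suffix (u : ℕ → Bool) (m : ℕ) : ∀ a,
    ∃ d j, ∀ r, runXor u r a m = ((r + j) % 4) ^^^ d := by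
  induction m with
  | zero => intro a; exact ⟨0, 0, fun r => by simp [runXor]⟩
  | succ m ih =>
    intro a
    cases h : u a with
    | true =>
      obtain ⟨d, j, hd⟩ := ih (a + 1)
      refine ⟨d, j + 1, fun r => ?_⟩
      rw [runXor_succ_true h, hd, show r + 1 + j = r + (j + 1) by omega]
    | false =>
      exact ⟨runXor u 0 (a + 1) m, 0, fun r => by rw [runXor_succ_false h]; rfl⟩

/-- The dependence of `runXor` on a prefix. -/
lemma exists_runXor_prefix (u : ℕ → Bool) (p : ℕ) : ∀ r a,
    ∃ c j, ∀ u' : ℕ → Bool, (∀ i, a ≤ i → i < a + p → u' i = u i) →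
      ∀ m, runXor u' r a (p + m) = c ^^^ runXor u' j (a + p) m := by
  induction p with
  | zero => intro r a; exact ⟨0, r, fun u' _ m => by simp⟩
  | succ p ih =>
    intro r a
    cases h : u a with
    | true =>
      obtain ⟨c, j, hc⟩ := ih (r + 1) (a + 1)
      refine ⟨c, j, fun u' hu m => ?_⟩
      rw [show p + 1 + m = (p + m) + 1 by omega,
        runXor_succ_true ((hu a le_rfl (by omega)).trans h),
        hc u' (fun i h1 h2 => hu i (by omega) (by omega)), show a + 1 + p = a + (p + 1) by omega]
    | false =>
      obtain ⟨c, j, hc⟩ := ih 0 (a + 1)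
      refine ⟨(r % 4) ^^^ c, j, fun u' hu m => ?_⟩
      rw [show p + 1 + m = (p + m) + 1 by omega,
        runXor_succ_false ((hu a le_rfl (by omega)).trans h),
        hc u' (fun i h1 h2 => hu i (by omega) (by omega)), show a + 1 + p = a + (p + 1) by omega,
        Nat.xor_assoc]

/-- Clearing three consecutive positions that are neither all clear nor an isolated gap
changes the XOR of the run lengths. -/
lemma runXor_ne_of_clear {u u' : ℕ → Bool} {v m : ℕ}
    (hplay : u v = true ∨ u (v + 1) = true ∨ u (v + 2) = true)
    (hgap : ¬ (u v = true ∧ u (v + 1) = false ∧ u (v + 2) = true))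
    (h0 : u' v = false) (h1 : u' (v + 1) = false) (h2 : u' (v + 2) = false)
    (hu : ∀ i, (i < v ∨ v + 2 < i) → u' i = u i) :
    runXor u 0 0 (v + (m + 3)) ≠ runXor u' 0 0 (v + (m + 3)) := by
  obtain ⟨c, i, hc⟩ := exists_runXor_prefix u v 0 0
  obtain ⟨d, j, hd⟩ := exists_runXor_suffix u m (v + 3)
  have hd' : ∀ r, runXor u' r (v + 3) m = ((r + j) % 4) ^^^ d := fun r => by
    rw [← hd, runXor_congr]
    exact fun i h1 _ => hu i (by omega)
  rw [hc u (fun _ _ _ => rfl), hc u' (fun i _ h => hu i (by omega))]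
  have key : ∀ x < 4, ∀ y < 4, (x + 3 + y) % 4 ≠ x ^^^ y := by decide
  have hij := key (i % 4) (by omega) (j % 4) (by omega)
  rw [show (i % 4 + 3 + j % 4) % 4 = (i + 1 + 1 + 1 + j) % 4 by omega] at hij
  cases a0 : u v <;> cases a1 : u (v + 1) <;> cases a2 : u (v + 2) <;>
    simp only [a0, a1, a2, Bool.false_eq_true, reduceCtorEq, and_self, not_true, or_self]
      at hplay hgap
  all_goals
    simp only [Nat.zero_add, ne_eq, Nat.xor_right_inj, runXor, h0, h1, h2, a0, a1, a2,
      Bool.false_eq_true, if_false, if_true, hd, hd', Nat.xor_left_inj, Nat.zero_mod, Nat.zero_xor]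
  case true.true.true => rwa [← Nat.xor_assoc, Nat.xor_left_inj]
  case false.true.false =>
    exact fun h => absurd (Nat.xor_left_inj.1 (h.trans (Nat.zero_xor _).symm)) (by decide)
  all_goals omega

/-- If a bit of the XOR is set, it is set in the length of some run. -/
lemma exists_run_of_testBit {u : ℕ → Bool} (b m : ℕ) : ∀ r a,
    (runXor u r a m).testBit b = true →
    (∃ k, k ≤ m ∧ (∀ i, a ≤ i → i < a + k → u i = true) ∧ ((r + k) % 4).testBit b = true ∧
      (k = m ∨ u (a + k) = false)) ∨
    (∃ p k, p + k + 1 ≤ a + m ∧ u p = false ∧ (∀ i, p < i → i < p + k + 1 → u i = true) ∧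
      (k % 4).testBit b = true ∧ (p + k + 1 = a + m ∨ u (p + k + 1) = false)) := by
  induction m with
  | zero => intro r a h; exact .inl ⟨0, le_rfl, fun i _ _ => by omega, h, .inl rfl⟩
  | succ m ih =>
    intro r a h
    cases hu : u a with
    | true =>
      rw [runXor_succ_true hu] at h
      rcases ih _ _ h with ⟨k, hk, ht, hb, he⟩ | ⟨p, k, hk, hp, ht, hb, he⟩
      · refine .inl ⟨k + 1, by omega, fun i h1 h2 => ?_, ?_, ?_⟩
        · rcases h1.eq_or_lt with rfl | h1
          · exact hu
          · exact ht i h1 (by omega)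
        · rwa [show r + (k + 1) = r + 1 + k by omega]
        · rw [show a + (k + 1) = a + 1 + k by omega]
          exact he.imp (by omega) id
      · exact .inr ⟨p, k, by omega, hp, ht, hb, he.imp (by omega) id⟩
    | false =>
      rw [runXor_succ_false hu, Nat.testBit_xor] at h
      by_cases hr : (r % 4).testBit b = true
      · exact .inl ⟨0, by omega, fun i _ _ => by omega, hr, .inr hu⟩
      · have h' : (runXor u 0 (a + 1) m).testBit b = true := by simpa [hr] using h
        rcases ih _ _ h' with ⟨k, hk, ht, hb, he⟩ | ⟨p, k, hk, hp, ht, hb, he⟩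
        · refine .inr ⟨a, k, by omega, hu, fun i h1 h2 => ht i (by omega) (by omega), ?_, ?_⟩
          · rwa [Nat.zero_add] at hb
          · rw [show a + k + 1 = a + 1 + k by omega]
            exact he.imp (by omega) id
        · exact .inr ⟨p, k, by omega, hp, ht, hb, he.imp (by omega) id⟩

lemma exists_bit_of_ne_zero : ∀ x < 4, x ≠ 0 →
    ∃ b, x.testBit b = true ∧ ∀ y < 4, y.testBit b = true → y ^^^ x < y := by
  intro x hx h0
  interval_cases x
  · exact absurd rfl h0
  · exact ⟨0, by decide, by decide⟩
  · exact ⟨1, by decide, by decide⟩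
  · exact ⟨1, by decide, by decide⟩

/-- The Nim move: if the XOR of the run lengths is nonzero, some run can be shortened by
one, two or three so that the XOR vanishes. -/
lemma exists_shortening {u : ℕ → Bool} {N : ℕ} (h0 : u 0 = false) (hlast : u N = false)
    (h : runXor u 0 0 (N + 1) ≠ 0) :
    ∃ p k d, 1 ≤ d ∧ d ≤ 3 ∧ d ≤ k ∧ p + k + 1 ≤ N ∧ u p = false ∧ u (p + k + 1) = false ∧
      (∀ i, p < i → i < p + k + 1 → u i = true) ∧
      ∀ u' : ℕ → Bool, (∀ i, (i ≤ p ∨ p + k + 1 ≤ i) → u' i = u i) →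
        runXor u' 0 (p + 1) k = (k - d) % 4 → runXor u' 0 0 (N + 1) = 0 := by
  obtain ⟨b, hb, hlt⟩ := exists_bit_of_ne_zero _ (runXor_lt u (N + 1) 0 0) h
  have hrun : ∃ p k, p + k + 1 ≤ N + 1 ∧ u p = false ∧
      (∀ i, p < i → i < p + k + 1 → u i = true) ∧ (k % 4).testBit b = true ∧
      (p + k + 1 = N + 1 ∨ u (p + k + 1) = false) := by
    rcases exists_run_of_testBit b _ _ _ hb with ⟨k, hk, ht, hkb, -⟩ | ⟨p, k, hk, hp, ht, hkb, he⟩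
    · rcases Nat.eq_zero_or_pos k with rfl | hpos
      · simp at hkb
      · simp [ht 0 le_rfl (by omega)] at h0
    · exact ⟨p, k, by omega, hp, ht, hkb, he.imp (by omega) id⟩
  obtain ⟨p, k, hk, hp, ht, hkb, he⟩ := hrun
  have hkpos : 1 ≤ k := by
    by_contra hc
    obtain rfl : k = 0 := by omega
    simp at hkb
  have hne : p + k + 1 ≠ N + 1 := fun hc => by
    have := ht N (by omega) (by omega)
    simp [hlast] at this
  have hq : u (p + k + 1) = false := he.resolve_left hne
  have hx := hlt (k % 4) (by omega) hkb
  have hsplit : ∀ u' : ℕ → Bool, (∀ i, (i ≤ p ∨ p + k + 1 ≤ i) → u' i = u i) →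
      runXor u' 0 0 (N + 1) = (runXor u 0 0 p ^^^ runXor u 0 (p + k + 1 + 1) (N - (p + k + 1))) ^^^
        runXor u' 0 (p + 1) k := by
    intro u' hu
    obtain ⟨m, rfl⟩ : ∃ m, N = p + k + 1 + m := ⟨N - (p + k + 1), by omega⟩
    rw [show p + k + 1 + m + 1 = p + 1 + (k + 1 + m) by omega,
      runXor_append p _ 0 0 (by rw [Nat.zero_add, hu p (by omega), hp]), Nat.zero_add,
      runXor_append k _ 0 (p + 1)
        (by rw [show p + 1 + k = p + k + 1 by omega, hu _ (by omega), hq]),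
      show p + 1 + k + 1 = p + k + 1 + 1 by omega, show p + k + 1 + m - (p + k + 1) = m by omega,
      runXor_congr (u := u') (u' := u) p 0 0 (fun i _ hi => hu i (by omega)),
      runXor_congr (u := u') (u' := u) m 0 _ (fun i hi _ => hu i (by omega)),
      Nat.xor_assoc, Nat.xor_comm (runXor u' 0 (p + 1) k)]
  have hu := hsplit u fun _ _ => rfl
  rw [runXor_single (u := u) (a := p + 1) (d := 0) (k := k) (m := 0) (by omega)
    (fun i _ _ => by omega) (fun i h1 h2 => ht i (by omega) (by omega))
    (fun i _ _ => by omega)] at hu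
  refine ⟨p, k, k % 4 - (k % 4 ^^^ runXor u 0 0 (N + 1)), by omega, by omega, by omega, by omega,
    hp, hq, ht, fun u' hu' hval => ?_⟩
  rw [hsplit u' hu', hval, show (k - (k % 4 - (k % 4 ^^^ runXor u 0 0 (N + 1)))) % 4 =
    k % 4 ^^^ runXor u 0 0 (N + 1) by omega, hu]
  generalize runXor u 0 0 p ^^^ runXor u 0 (p + k + 1 + 1) (N - (p + k + 1)) = c
  rw [Nat.xor_comm c (k % 4), ← Nat.xor_assoc (k % 4), Nat.xor_self, Nat.zero_xor, Nat.xor_self]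

/-- The indicator function of the vertices of the path not dominated by `S`; the vertex `i` is
placed at position `i + 1`. -/
def undominated {n : ℕ} (S : Finset (Fin n)) (i : ℕ) : Bool :=
  decide (1 ≤ i ∧ i ≤ n ∧ ∀ s ∈ S, ¬ (s.val ≤ i ∧ i ≤ s.val + 2))

lemma undominated_eq_true {n : ℕ} {S : Finset (Fin n)} {i : ℕ} :
    undominated S i = true ↔ 1 ≤ i ∧ i ≤ n ∧ ∀ s ∈ S, ¬ (s.val ≤ i ∧ i ≤ s.val + 2) := by
  simp only [undominated, decide_eq_true_eq]

lemma undominated_insert {n : ℕ} (S : Finset (Fin n)) (v : Fin n) (i : ℕ) :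
    undominated (insert v S) i = (undominated S i && !decide (v.val ≤ i ∧ i ≤ v.val + 2)) := by
  rw [Bool.eq_iff_iff, Bool.and_eq_true, undominated_eq_true, undominated_eq_true,
    Finset.forall_mem_insert]
  simp only [Bool.not_eq_true', decide_eq_false_iff_not]
  tauto

lemma dominated_pathGraph_iff {n : ℕ} {S : Finset (Fin n)} {w : Fin n} :
    Dominated (pathGraph n) S w ↔ ∃ s ∈ S, s.val ≤ w.val + 1 ∧ w.val + 1 ≤ s.val + 2 := by
  refine exists_congr fun s => and_congr_right fun _ => ?_
  rw [pathGraph_adj, Fin.ext_iff]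
  omega

lemma undominated_succ {n : ℕ} {S : Finset (Fin n)} {w : Fin n} :
    undominated S (w.val + 1) = true ↔ ¬ Dominated (pathGraph n) S w := by
  rw [undominated_eq_true, dominated_pathGraph_iff]
  push Not
  have := w.isLt
  constructor
  · rintro ⟨-, -, h⟩ s hs h1
    have := h s hs
    omega
  · intro h
    refine ⟨by omega, by omega, fun s hs => ?_⟩
    have := h s hs
    omega

lemma playable_pathGraph_iff {n : ℕ} {S : Finset (Fin n)} {v : Fin n} :
    Playable (pathGraph n) S v ↔ undominated S v.val = true ∨
      undominated S (v.val + 1) = true ∨ undominated S (v.val + 2) = true := by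
  constructor
  · rintro ⟨w, hw, hd⟩
    rw [← undominated_succ] at hd
    rw [pathGraph_adj, Fin.ext_iff] at hw
    have : w.val + 1 = v.val ∨ w.val + 1 = v.val + 1 ∨ w.val + 1 = v.val + 2 := by omega
    rcases this with h | h | h <;> rw [h] at hd <;> simp [hd]
  · have key : ∀ i, undominated S i = true → v.val ≤ i → i ≤ v.val + 2 →
        Playable (pathGraph n) S v := by
      intro i hi h1 h2
      obtain ⟨h3, h4, -⟩ := undominated_eq_true.1 hi
      refine ⟨⟨i - 1, by omega⟩, ?_, ?_⟩
      · rw [pathGraph_adj, Fin.ext_iff]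
        simp only
        omega
      · rw [← undominated_succ]
        simpa only [Nat.sub_add_cancel h3] using hi
    rintro (h | h | h)
    · exact key _ h (by omega) (by omega)
    · exact key _ h (by omega) (by omega)
    · exact key _ h (by omega) (by omega)

lemma undominated_no_isolated_gap {n : ℕ} (S : Finset (Fin n)) (i : ℕ) :
    ¬ (undominated S i = true ∧ undominated S (i + 1) = false ∧
      undominated S (i + 2) = true) := by
  rintro ⟨h1, h2, h3⟩
  rw [← Bool.not_eq_true, undominated_eq_true] at h2
  rw [undominated_eq_true] at h1 h3
  refine h2 ⟨by omega, by omega, fun s hs => ?_⟩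
  have := h1.2.2 s hs
  have := h3.2.2 s hs
  omega

/-- The XOR of the run lengths of undominated vertices, modulo 4. -/
def pathXor {n : ℕ} (S : Finset (Fin n)) : ℕ := runXor (undominated S) 0 0 (n + 1 + 1)

lemma pathXor_insert_ne {n : ℕ} {S : Finset (Fin n)} {v : Fin n}
    (h : Playable (pathGraph n) S v) : pathXor S ≠ pathXor (insert v S) := by
  obtain ⟨m, hm⟩ : ∃ m, n + 1 + 1 = v.val + (m + 3) := ⟨n - 1 - v.val, by have := v.isLt; omega⟩
  unfold pathXor
  rw [hm]
  refine runXor_ne_of_clear (playable_pathGraph_iff.1 h) (undominated_no_isolated_gap S v.val)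
    ?_ ?_ ?_ fun i hi => ?_
  · simp [undominated_insert]
  · simp [undominated_insert]
  · simp [undominated_insert]
  · have : ¬ (v.val ≤ i ∧ i ≤ v.val + 2) := by omega
    simp [undominated_insert, this]

lemma exists_pathXor_insert_eq_zero {n : ℕ} {S : Finset (Fin n)} (hS : S.Nonempty)
    (h : pathXor S ≠ 0) : ∃ v, Playable (pathGraph n) S v ∧ pathXor (insert v S) = 0 := by
  have h0 : undominated S 0 = false := by
    rw [← Bool.not_eq_true, undominated_eq_true]; omega
  have hn : undominated S (n + 1) = false := by
    rw [← Bool.not_eq_true, undominated_eq_true]; omega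
  obtain ⟨p, k, d, hd1, hd3, hdk, hkN, hp, hq, ht, hu⟩ := exists_shortening h0 hn h
  rcases Nat.eq_zero_or_pos p with rfl | hpos
  · have hkn : k < n := by
      by_contra hc
      obtain ⟨s, hs⟩ := hS
      have hlt := s.isLt
      have := (undominated_eq_true.1 (ht (s.val + 1) (by omega) (by omega))).2.2 s hs
      omega
    have hv : k + 1 - d < n := by omega
    have hgap : d = 1 → undominated S (k + 2) = false := fun _ => by
      have := undominated_no_isolated_gap S k
      rw [Nat.zero_add] at hq
      have hk := ht k (by omega) (by omega)
      simpa [hq, hk] using this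
    have hins : ∀ i, undominated (insert ⟨k + 1 - d, hv⟩ S) i =
        (undominated S i && !decide (k + 1 - d ≤ i ∧ i ≤ k)) := by
      intro i
      rw [undominated_insert]
      by_cases hi : i ≤ k
      · have : i ≤ k + 1 - d + 2 := by omega
        simp [hi, this]
      · by_cases hi1 : i = k + 1
        · rw [Nat.zero_add] at hq
          simp [hi1, hq]
        · by_cases hi2 : i = k + 2 ∧ d = 1
          · simp [hi2.1, hgap hi2.2]
          · have : ¬ i ≤ k + 1 - d + 2 := by omega
            simp [hi, this]
    refine ⟨⟨k + 1 - d, hv⟩, ?_, hu _ (fun i hi => ?_) ?_⟩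
    · exact playable_pathGraph_iff.2 (.inl (ht (k + 1 - d) (by omega) (by omega)))
    · have : ¬ (k + 1 - d ≤ i ∧ i ≤ k) := by omega
      simp only [hins, this, decide_false, Bool.not_false, Bool.and_true]
    · refine runXor_single (d := 0) (k := k - d) (m := d) (by omega) (fun i _ _ => by omega)
        (fun i h1 h2 => ?_) (fun i h1 h2 => ?_)
      · have : ¬ (k + 1 - d ≤ i ∧ i ≤ k) := by omega
        simp only [hins, this, decide_false, Bool.not_false, Bool.and_true]
        exact ht i (by omega) (by omega)
      · have : k + 1 - d ≤ i ∧ i ≤ k := by omega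
        simp [hins, this]
  · have hv : p + d - 2 < n := by omega
    have hgap : d = 1 → undominated S (p - 1) = false := fun _ => by
      have := undominated_no_isolated_gap S (p - 1)
      rw [show p - 1 + 1 = p by omega, show p - 1 + 2 = p + 1 by omega] at this
      have hk := ht (p + 1) (by omega) (by omega)
      simpa [hp, hk] using this
    have hins : ∀ i, undominated (insert ⟨p + d - 2, hv⟩ S) i =
        (undominated S i && !decide (p + 1 ≤ i ∧ i ≤ p + d)) := by
      intro i
      rw [undominated_insert]
      by_cases hi : p + 1 ≤ i
      · have h1 : p + d - 2 ≤ i ∧ i ≤ p + d - 2 + 2 ↔ p + 1 ≤ i ∧ i ≤ p + d := by omega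
        simp only [h1]
      · by_cases hi1 : i = p
        · simp [hi1, hp]
        · by_cases hi2 : i = p - 1 ∧ d = 1
          · simp [hi2.1, hgap hi2.2]
          · have : ¬ p + d - 2 ≤ i := by omega
            simp [hi, this]
    refine ⟨⟨p + d - 2, hv⟩, ?_, hu _ (fun i hi => ?_) ?_⟩
    · exact playable_pathGraph_iff.2 (.inr (.inr (ht (p + d - 2 + 2) (by omega) (by omega))))
    · have : ¬ (p + 1 ≤ i ∧ i ≤ p + d) := by omega
      simp only [hins, this, decide_false, Bool.not_false, Bool.and_true]
    · refine runXor_single (d := d) (k := k - d) (m := 0) (by omega) (fun i h1 h2 => ?_)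
        (fun i h1 h2 => ?_) (fun i _ _ => by omega)
      · have : p + 1 ≤ i ∧ i ≤ p + d := by omega
        simp [hins, this]
      · have : ¬ (p + 1 ≤ i ∧ i ≤ p + d) := by omega
        simp only [hins, this, decide_false, Bool.not_false, Bool.and_true]
        exact ht i (by omega) (by omega)

lemma firstWins_iff_exists {V : Type} [Fintype V] [DecidableEq V] (G : SimpleGraph V)
    (S : Finset V) : FirstWins G S ↔ ∃ v, Playable G S v ∧ ¬ FirstWins G (insert v S) := by
  rw [FirstWins]
  simp only [exists_prop]

lemma firstWins_pathGraph_iff {n : ℕ} (S : Finset (Fin n)) (hS : S.Nonempty) :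
    FirstWins (pathGraph n) S ↔ pathXor S ≠ 0 := by
  rw [firstWins_iff_exists]
  constructor
  · rintro ⟨v, hv, hw⟩ h0
    rw [firstWins_pathGraph_iff (insert v S) (Finset.insert_nonempty v S), not_not] at hw
    exact pathXor_insert_ne hv (h0.trans hw.symm)
  · intro h
    obtain ⟨v, hv, h0⟩ := exists_pathXor_insert_eq_zero hS h
    refine ⟨v, hv, ?_⟩
    rw [firstWins_pathGraph_iff (insert v S) (Finset.insert_nonempty v S), not_not]
    exact h0
termination_by (Finset.univ \ S).card
decreasing_by all_goals exact hv.card_lt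

lemma pathXor_singleton {n : ℕ} (v : Fin n) :
    pathXor {v} = ((v.val - 1) % 4) ^^^ ((n - 2 - v.val) % 4) := by
  have hv := v.isLt
  have hu : ∀ i, undominated {v} i = decide (1 ≤ i ∧ i ≤ n ∧ ¬ (v.val ≤ i ∧ i ≤ v.val + 2)) := by
    intro i
    simp [undominated]
  unfold pathXor
  rw [show n + 1 + 1 = v.val + 1 + 1 + (n - v.val) by omega, runXor_append (v.val + 1) (n - v.val)]
  · congr 1
    · refine runXor_single (d := 1) (m := v.val + 1 - (1 + (v.val - 1))) (by omega)
        (fun i _ _ => ?_) (fun i _ _ => ?_) (fun i _ _ => ?_)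
      all_goals
        simp only [hu, decide_eq_true_eq, decide_eq_false_iff_not]
        omega
    · refine runXor_single (d := 1) (m := n - v.val - (1 + (n - 2 - v.val))) (by omega)
        (fun i _ _ => ?_) (fun i _ _ => ?_) (fun i _ _ => ?_)
      all_goals
        simp only [hu, decide_eq_true_eq, decide_eq_false_iff_not]
        omega
  · simp only [hu, decide_eq_false_iff_not]
    omega

theorem firstWins_path_iff (n : ℕ) (hn : 1 ≤ n) :
    (¬ FirstWins (SimpleGraph.pathGraph n) ∅ ↔ 4 ∣ n) ∧
    (FirstWins (SimpleGraph.pathGraph n) ∅ ↔ n % 4 ≠ 0) := by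
  have key : FirstWins (SimpleGraph.pathGraph n) ∅ ↔ n % 4 ≠ 0 := by
    have hmove : FirstWins (SimpleGraph.pathGraph n) ∅ ↔
        ∃ v : Fin n, (v.val - 1) % 4 = (n - 2 - v.val) % 4 := by
      rw [firstWins_iff_exists]
      refine exists_congr fun v => ?_
      have hv : Playable (pathGraph n) ∅ v := ⟨v, .inl rfl, by simp [Dominated]⟩
      rw [firstWins_pathGraph_iff _ (Finset.insert_nonempty v ∅), insert_empty_eq,
        pathXor_singleton, not_not, Nat.xor_eq_zero_iff]
      exact and_iff_right hv
    rw [hmove]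
    constructor
    · rintro ⟨⟨v, hv⟩, h⟩
      simp only at h
      omega
    · intro h
      by_cases h2 : n % 4 = 2
      · exact ⟨⟨0, by omega⟩, by simp only; omega⟩
      · exact ⟨⟨(n - 1) / 2, by omega⟩, by simp only; omega⟩
  refine ⟨?_, key⟩
  rw [key, not_not, Nat.dvd_iff_mod_eq_zero]
end
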